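/- arXiv:math/0411091 — 2 statements merged into one kernel-verified Lean document; each statement's English description precedes it below -/
import Mathlib

section
/- If S is a prefix-free set of finite binary strings and p is a finite binary string that is incomparable with every element of S (p is not a prefix of any element of S and no element of S is a prefix of p), then ∑_{s ∈ S} 2^{-|s|} ≤ 1 - 2^{-|p|}; consequently, if in addition S is nonempty, then 0 < ∑_{s ∈ S} 2^{-|s|} < 1. -/
/-- A set of finite binary strings is prefix-free if no element is a proper
prefix of another element. -/
def PrefixFree (S : Set (List Bool)) : Prop :=
  ∀ s ∈ S, ∀ t ∈ S, s <+: t → s = t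

open InformationTheory in
/-- A prefix-free set of nonempty binary strings is uniquely decodable. -/
theorem PrefixFree.uniquelyDecodable {S : Set (List Bool)} (hS : PrefixFree S) (h0 : [] ∉ S) :
    UniquelyDecodable S := by
  intro L₁
  induction L₁ with
  | nil =>
    intro L₂ _ h₂ h
    cases L₂ with
    | nil => rfl
    | cons b L₂ =>
      have hb : b = [] := by simp_all
      exact absurd (hb ▸ h₂ b (by simp)) h0
  | cons a L₁ ih =>
    intro L₂ h₁ h₂ h
    have ha : a ∈ S := h₁ a (by simp)
    cases L₂ with
    | nil =>
      have ha' : a = [] := by simp_all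
      exact absurd (ha' ▸ ha) h0
    | cons b L₂ =>
      have hb : b ∈ S := h₂ b (by simp)
      rw [List.flatten_cons, List.flatten_cons] at h
      have hab : a = b :=
        (List.prefix_or_prefix_of_prefix (List.prefix_append a L₁.flatten)
          (h ▸ List.prefix_append b L₂.flatten)).elim (hS a ha b hb)
          fun hba => (hS b hb a ha hba).symm
      subst hab
      rw [ih L₂ (fun w hw => h₁ w (by simp [hw])) (fun w hw => h₂ w (by simp [hw]))
        (List.append_cancel_left h)]

/-- **Kraft's inequality** for finite prefix-free sets of binary strings. -/
theorem PrefixFree.sum_le_one {F : Finset (List Bool)} (hF : PrefixFree (F : Set (List Bool))) :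
    ∑ s ∈ F, (2 : ℝ) ^ (-(s.length : ℤ)) ≤ 1 := by
  by_cases h0 : [] ∈ F
  · have hF0 : F = {[]} := by
      refine Finset.eq_singleton_iff_unique_mem.2 ⟨h0, fun s hs => ?_⟩
      exact (hF [] h0 s hs List.nil_prefix).symm
    simp [hF0]
  · simpa using InformationTheory.kraft_mcmillan_inequality
      (hF.uniquelyDecodable (by simpa using h0))

/-- Adding to a prefix-free set a string incomparable with all its elements keeps it
prefix-free. -/
theorem PrefixFree.insert {S : Set (List Bool)} (hS : PrefixFree S) {p : List Bool}
    (hp : ∀ s ∈ S, ¬ p <+: s ∧ ¬ s <+: p) : PrefixFree (Insert.insert p S) := by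
  rintro s (rfl | hs) t (rfl | ht) hst
  · rfl
  · exact absurd hst (hp t ht).1
  · exact absurd hst (hp s hs).2
  · exact hS s hs t ht hst

theorem PrefixFree.mono {S T : Set (List Bool)} (hT : PrefixFree T) (hST : S ⊆ T) :
    PrefixFree S :=
  fun s hs t ht => hT s (hST hs) t (hST ht)

theorem weight_lt_one_of_incomparable (S : Set (List Bool)) (hS : PrefixFree S)
    (p : List Bool) (hp : ∀ s ∈ S, ¬ p <+: s ∧ ¬ s <+: p) :
    (∑' s : S, (2 : ℝ) ^ (-(s.1.length : ℤ))) ≤ 1 - (2 : ℝ) ^ (-(p.length : ℤ)) ∧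
      (S.Nonempty →
        0 < ∑' s : S, (2 : ℝ) ^ (-(s.1.length : ℤ)) ∧
          ∑' s : S, (2 : ℝ) ^ (-(s.1.length : ℤ)) < 1) := by
  have hpos : ∀ s : S, 0 < (2 : ℝ) ^ (-(s.1.length : ℤ)) := fun s => by positivity
  have hp_pos : 0 < (2 : ℝ) ^ (-(p.length : ℤ)) := by positivity
  have hfin : ∀ F : Finset S,
      ∑ s ∈ F, (2 : ℝ) ^ (-(s.1.length : ℤ)) ≤ 1 - (2 : ℝ) ^ (-(p.length : ℤ)) := by
    intro F
    set G : Finset (List Bool) := F.map (Function.Embedding.subtype _) with hG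
    have hGS : (G : Set (List Bool)) ⊆ S := by
      intro s hs
      obtain ⟨t, -, rfl⟩ := Finset.mem_map.1 (Finset.mem_coe.1 hs)
      exact t.2
    have hpG : p ∉ G := fun h => (hp p (hGS h)).1 List.prefix_rfl
    have hle := PrefixFree.sum_le_one (F := Insert.insert p G)
      ((hS.insert hp).mono (by
        rw [Finset.coe_insert]
        exact Set.insert_subset_insert hGS))
    rw [Finset.sum_insert hpG, hG, Finset.sum_map] at hle
    exact le_sub_iff_add_le'.2 hle
  have hsum : Summable fun s : S => (2 : ℝ) ^ (-(s.1.length : ℤ)) :=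
    summable_of_sum_le (fun s => (hpos s).le) hfin
  have hle := hsum.tsum_le_of_sum_le hfin
  refine ⟨hle, fun ⟨s, hs⟩ => ⟨hsum.tsum_pos (fun s => (hpos s).le) ⟨s, hs⟩ (hpos _), ?_⟩⟩
  linarith
end

section
/- No algorithm can exhibit numbers of arbitrarily high complexity: there is no computable function f : ℕ → ℕ such that K(f(N)) > N for every N. In particular, the function mapping N to the smallest natural number n with K(n) > N (which exists since K is unbounded) is not computable. -/
/-- The complexity of `n` : the least code (as a natural number) that outputs
`n` on input `0`. -/
noncomputable def K (n : ℕ) : ℕ :=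
  sInf {e | (Denumerable.ofNat Nat.Partrec.Code e).eval 0 = Part.some n}

open Nat.Partrec

theorem K_le_encode {c : Code} {n : ℕ} (h : c.eval 0 = Part.some n) :
    K n ≤ Encodable.encode c :=
  Nat.sInf_le (by simpa using h)

theorem eval_ofNat_K (n : ℕ) : (Denumerable.ofNat Code (K n)).eval 0 = Part.some n :=
  Nat.sInf_mem (s := {e | (Denumerable.ofNat Code e).eval 0 = Part.some n})
    ⟨Encodable.encode (Code.const n), by simp⟩

theorem K_injective : Function.Injective K := fun m n h =>
  Part.some_inj.1 <| by rw [← eval_ofNat_K m, h, eval_ofNat_K n]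

theorem exists_K_gt (N : ℕ) : ∃ n, K n > N := by
  obtain ⟨_, ⟨n, rfl⟩, hn⟩ := (Set.infinite_range_of_injective K_injective).exists_gt N
  exact ⟨n, hn⟩

/-- By the second recursion theorem, some code outputs the value of `f` at its own number. -/
theorem exists_K_le {f : ℕ → ℕ} (hf : Computable f) : ∃ N, K (f N) ≤ N := by
  have hg : Computable₂ fun (c : Code) (_ : ℕ) => f (Encodable.encode c) :=
    hf.comp (Computable.encode.comp Computable.fst)
  obtain ⟨c, hc⟩ := Code.fixed_point₂ hg.partrec₂
  exact ⟨Encodable.encode c, K_le_encode (congrFun hc 0)⟩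

theorem no_computable_high_complexity :
    (¬ ∃ f : ℕ → ℕ, Computable f ∧ ∀ N : ℕ, K (f N) > N) ∧
      ¬ Computable (fun N : ℕ => sInf {n : ℕ | K n > N}) := by
  have no_computable : ¬ ∃ f : ℕ → ℕ, Computable f ∧ ∀ N : ℕ, K (f N) > N := by
    rintro ⟨f, hf, h⟩
    obtain ⟨N, hN⟩ := exists_K_le hf
    exact (h N).not_ge hN
  exact ⟨no_computable, fun h => no_computable ⟨_, h, fun N => Nat.sInf_mem (exists_K_gt N)⟩⟩
end
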